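/- (Cigler's conjecture, case k=1, odd) For all m ≥ 1 and n ≥ 0, det(C_{1, i+j+1-m})_{i,j=0}^{n+m-1} = (-1)^{binom(m,2)} · det(C_{1, i+j+m})_{i,j=0}^{n-1}, where C_{1,p} is the p-th Catalan number and an empty determinant equals 1. -/

import Mathlib

/-- `C_{1,p}` is the `p`-th Catalan number for `p ≥ 0`, and `0` for `p < 0`. -/
def catalanZ (p : ℤ) : ℤ :=
  if p < 0 then 0 else (catalan p.toNat : ℤ)

open Finset Matrix in
theorem anti_det (S : ℕ) : ∀ (M : Matrix (Fin S) (Fin S) ℤ),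
    (∀ i j : Fin S, (i : ℕ) + j + 1 < S → M i j = 0) →
    (∀ i j : Fin S, (i : ℕ) + j + 1 = S → M i j = 1) → M.det = (-1) ^ (S.choose 2) := by
  induction S with
  | zero => intro M _ _; simp
  | succ S ih =>
    intro M h0 h1
    rw [det_succ_row_zero, Finset.sum_eq_single (Fin.last S)]
    · rw [h1 0 (Fin.last S) (by simp), ih]
      · simp [Nat.choose_succ_succ' S 1, pow_add]
      · intro i j h
        simp only [submatrix_apply, Fin.succAbove_last]
        apply h0; simp; omega
      · intro i j h
        simp only [submatrix_apply, Fin.succAbove_last]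
        apply h1; simp; omega
    · intro b _ hb
      rw [h0 0 b]
      · simp
      · have : (b : ℕ) ≠ S := fun h => hb (Fin.ext (by simpa using h))
        have := b.2
        simp; omega
    · simp

theorem catalanZ_neg {p : ℤ} (h : p < 0) : catalanZ p = 0 := by simp [catalanZ, h]

theorem catalanZ_nat (p : ℕ) : catalanZ (p : ℤ) = catalan p := by simp [catalanZ]

/-- coefficients of the inverse series -/
def dZ (p : ℤ) : ℤ := (if p = 0 then 1 else 0) - catalanZ (p - 1)

theorem conv_aux (S i j : ℕ) (hi : i < S) :
    ∑ l ∈ Finset.range S, catalanZ ((i : ℤ) - l) * catalanZ ((l : ℤ) - j - 1) =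
      catalanZ ((i : ℤ) - j) - if i = j then 1 else 0 := by
  rcases lt_or_ge j i with h | h
  · obtain ⟨t, rfl⟩ := Nat.exists_eq_add_of_lt h
    have e : ((j + t + 1 : ℕ) : ℤ) - j = ((t + 1 : ℕ) : ℤ) := by push_cast; ring
    rw [e, catalanZ_nat, if_neg (by omega), catalan_succ', Finset.Nat.sum_antidiagonal_eq_sum_range_succ
      (fun a b => catalan a * catalan b), sub_zero]
    have hS : S = (j + 1) + ((t + 1) + (S - (j + t + 2))) := by omega
    rw [hS, Finset.sum_range_add _ (j + 1), Finset.sum_range_add _ (t + 1),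
      Finset.sum_eq_zero (s := Finset.range (j + 1)), zero_add,
      Finset.sum_eq_zero (s := Finset.range (S - (j + t + 2))), add_zero]
    · push_cast
      apply Finset.sum_congr rfl
      intro a ha
      have ha' := Finset.mem_range.1 ha
      rw [show ((j : ℤ) + t + 1 - (j + 1 + a)) = ((t - a : ℕ) : ℤ) by omega,
        show ((j : ℤ) + 1 + a - j - 1) = (a : ℤ) by ring, catalanZ_nat, catalanZ_nat, mul_comm]
    · intro a _
      rw [catalanZ_neg (by push_cast; omega), zero_mul]
    · intro a ha
      have ha' := Finset.mem_range.1 ha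
      rw [catalanZ_neg (p := (a : ℤ) - j - 1) (by omega), mul_zero]
  · rw [Finset.sum_eq_zero]
    · rcases h.eq_or_lt with h | h
      · subst h; simp [catalanZ]
      · rw [if_neg (by omega), catalanZ_neg (by omega)]; rfl
    · intro l _
      rcases le_or_gt l i with h' | h'
      · rw [catalanZ_neg (p := (l : ℤ) - j - 1) (by omega), mul_zero]
      · rw [catalanZ_neg (by omega), zero_mul]

theorem conv_main (S i j : ℕ) (hi : i < S) (hj : j < S) :
    ∑ l ∈ Finset.range S, catalanZ ((i : ℤ) - l) * dZ ((l : ℤ) - j) =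
      if i = j then 1 else 0 := by
  simp only [dZ, mul_sub, Finset.sum_sub_distrib]
  rw [conv_aux S i j hi, Finset.sum_eq_single j]
  · simp
  · intro b _ hb
    rw [if_neg (by omega), mul_zero]
  · intro h; exact absurd (Finset.mem_range.2 hj) h

theorem hankel_inv (S : ℕ) :
    (Matrix.of fun i j : Fin S => catalanZ ((i : ℕ) + (j : ℕ) + 1 - S)) *
      (Matrix.of fun i j : Fin S => dZ ((S : ℤ) - 1 - (i : ℕ) - (j : ℕ))) = 1 := by
  ext i j
  rw [Matrix.mul_apply, ← Equiv.sum_comp Fin.revPerm, Matrix.one_apply]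
  have := conv_main S i j i.2 j.2
  rw [Finset.sum_range] at this
  simp only [← Fin.ext_iff] at this
  rw [← this]
  apply Finset.sum_congr rfl
  intro l _
  have := l.2
  simp only [Matrix.of_apply, Fin.revPerm_apply, Fin.val_rev]
  congr 2 <;> omega

open Matrix in
theorem block_det {α β : Type*} [Fintype α] [Fintype β] [DecidableEq α] [DecidableEq β]
    (H G : Matrix (α ⊕ β) (α ⊕ β) ℤ) (h : H * G = 1) (h0 : H.toBlocks₁₁ = 0) :
    H.toBlocks₂₂.det = H.det * G.toBlocks₁₁.det := by
  rw [← fromBlocks_toBlocks H, ← fromBlocks_toBlocks G, fromBlocks_multiply, ← fromBlocks_one,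
    fromBlocks_inj] at h
  obtain ⟨h1, -, h3, -⟩ := h
  have key : H * fromBlocks G.toBlocks₁₁ 0 G.toBlocks₂₁ 1 =
      fromBlocks 1 H.toBlocks₁₂ 0 H.toBlocks₂₂ := by
    conv_lhs => rw [← fromBlocks_toBlocks H]
    rw [fromBlocks_multiply, h1, h3]
    simp
  have := congrArg det key
  rw [det_mul, det_fromBlocks_zero₁₂, det_fromBlocks_zero₂₁] at this
  simpa using this.symm

/-- Cigler's conjecture for `k = 1`, odd case. -/
theorem cigler_k_one_odd (m n : ℕ) (hm : 1 ≤ m) :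
    Matrix.det (Matrix.of fun i j : Fin (n + m) =>
        catalanZ ((i : ℕ) + (j : ℕ) + 1 - m)) =
      (-1) ^ (m.choose 2) *
        Matrix.det (Matrix.of fun i j : Fin n =>
          catalanZ ((i : ℕ) + (j : ℕ) + m)) := by
  set H := (Matrix.of fun i j : Fin (n + (n + m)) =>
    catalanZ ((i : ℕ) + (j : ℕ) + 1 - (n + (n + m) : ℕ))) with hH
  set G := (Matrix.of fun i j : Fin (n + (n + m)) =>
    dZ (((n + (n + m) : ℕ) : ℤ) - 1 - (i : ℕ) - (j : ℕ))) with hG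
  have hinv : H * G = 1 := hankel_inv _
  have hdet : H.det = (-1) ^ ((n + (n + m)).choose 2) := by
    apply anti_det
    · intro i j h
      simp only [hH, Matrix.of_apply]
      exact catalanZ_neg (by omega)
    · intro i j h
      simp only [hH, Matrix.of_apply]
      rw [show ((i : ℕ) : ℤ) + (j : ℕ) + 1 - (n + (n + m) : ℕ) = ((0 : ℕ) : ℤ) by omega,
        catalanZ_nat, catalan_zero]; rfl
  let e : Fin n ⊕ Fin (n + m) ≃ Fin (n + (n + m)) := finSumFinEquiv
  have hb := block_det (H.submatrix e e) (G.submatrix e e)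
    (by rw [Matrix.submatrix_mul_equiv, hinv, Matrix.submatrix_one_equiv])
    (by
      ext i j
      have := i.2
      have := j.2
      simp only [Matrix.toBlocks₁₁, hH, e, Matrix.of_apply, Matrix.submatrix_apply,
        finSumFinEquiv_apply_left, Fin.val_castAdd, Matrix.zero_apply]
      exact catalanZ_neg (by push_cast; omega))
  rw [Matrix.det_submatrix_equiv_self, hdet] at hb
  have hA : (H.submatrix e e).toBlocks₂₂ = Matrix.of fun i j : Fin (n + m) =>
        catalanZ ((i : ℕ) + (j : ℕ) + 1 - m) := by
    ext i j
    simp only [Matrix.toBlocks₂₂, hH, e, Matrix.of_apply, Matrix.submatrix_apply,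
      finSumFinEquiv_apply_right, Fin.val_natAdd]
    congr 1; push_cast; ring
  have hB : (G.submatrix e e).toBlocks₁₁ = -((Matrix.of fun i j : Fin n =>
          catalanZ ((i : ℕ) + (j : ℕ) + m)).submatrix Fin.revPerm Fin.revPerm) := by
    ext i j
    have := i.2
    have := j.2
    simp only [Matrix.toBlocks₁₁, hG, e, Matrix.of_apply, Matrix.submatrix_apply,
      finSumFinEquiv_apply_left, Fin.val_castAdd, Matrix.neg_apply, Fin.revPerm_apply,
      Fin.val_rev, dZ]
    rw [if_neg (by push_cast; omega), zero_sub]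
    congr 2; omega
  rw [hA, hB, Matrix.det_neg, Matrix.det_submatrix_equiv_self, Fintype.card_fin] at hb
  rw [hb, ← mul_assoc, ← pow_add]
  congr 1
  have hc : (n + (n + m)).choose 2 + n = m.choose 2 + 2 * (n * m + n * n) := by
    have h2 : ∀ k : ℕ, ((k.choose 2 : ℕ) : ℚ) = k * (k - 1) / 2 := fun k => Nat.cast_choose_two ℚ k
    have : (((n + (n + m)).choose 2 + n : ℕ) : ℚ) = (m.choose 2 + 2 * (n * m + n * n) : ℕ) := by
      push_cast [h2]; ring
    exact_mod_cast this
  rw [hc, pow_add, pow_mul]; simp
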